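/- arXiv:1803.03210 — 3 statements merged into one kernel-verified Lean document; each statement's English description precedes it below -/
import Mathlib

section
/- Let R be a commutative ring and let x, y, v ∈ R be units satisfying 1 + x·y = v⁻¹·x + v·y. Define [a,b,c] = x·a − x·y·b + y·c and ⟨a,b,c⟩ = v·a − b + v⁻¹·c. Then for all a, b, c, d ∈ R, the mixed identity [a,b,⟨b,c,d⟩] = ⟨a,⟨a,b,c⟩,[⟨a,b,c⟩,c,d]⟩ holds (axiom (v.i) of a virtual tribracket). -/
/-- Axiom (v.i) for the Alexander virtual tribracket with
`T a b c = x·a − x·y·b + y·c`, `V a b c = v·a − b + v⁻¹·c` and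
compatibility `1 + x·y = v⁻¹·x + v·y`:
`[a,b,⟨b,c,d⟩] = ⟨a,⟨a,b,c⟩,[⟨a,b,c⟩,c,d]⟩`. -/
theorem alexander_virtual_tribracket_axiom_v_i {R : Type*} [CommRing R] (x y v : Rˣ)
    (hcompat : (1 : R) + x * y = (v⁻¹ : Rˣ) * x + v * y)
    (T : R → R → R → R) (hT : ∀ a b c : R, T a b c = x * a - x * y * b + y * c)
    (V : R → R → R → R) (hV : ∀ a b c : R, V a b c = v * a - b + (v⁻¹ : Rˣ) * c) :
    ∀ a b c d : R, T a b (V b c d) = V a (V a b c) (T (V a b c) c d) := by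
  intro a b c d
  have hv : (v : R) * (v⁻¹ : Rˣ) = 1 := v.mul_inv
  simp only [hT, hV]
  linear_combination (c * (v⁻¹ : Rˣ) - b) * hcompat + (c * y - a * x) * hv
end

section
/- Let R be a commutative ring and let x, y, v ∈ R be units satisfying 1 + x·y = v⁻¹·x + v·y. Define [a,b,c] = x·a − x·y·b + y·c and ⟨a,b,c⟩ = v·a − b + v⁻¹·c. Then for all a, b, c, d ∈ R, the mixed identity [⟨a,b,c⟩,c,d] = ⟨[a,b,⟨b,c,d⟩],⟨b,c,d⟩,d⟩ holds (axiom (v.ii) of a virtual tribracket). -/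
/-- Axiom (v.ii) for the Alexander virtual tribracket with
`T a b c = x·a − x·y·b + y·c`, `V a b c = v·a − b + v⁻¹·c` and
compatibility `1 + x·y = v⁻¹·x + v·y`:
`[⟨a,b,c⟩,c,d] = ⟨[a,b,⟨b,c,d⟩],⟨b,c,d⟩,d⟩`. -/
theorem alexander_virtual_tribracket_axiom_v_ii {R : Type*} [CommRing R] (x y v : Rˣ)
    (hcompat : (1 : R) + x * y = (v⁻¹ : Rˣ) * x + v * y)
    (T : R → R → R → R) (hT : ∀ a b c : R, T a b c = x * a - x * y * b + y * c)
    (V : R → R → R → R) (hV : ∀ a b c : R, V a b c = v * a - b + (v⁻¹ : Rˣ) * c) :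
    ∀ a b c d : R, T (V a b c) c d = V (T a b (V b c d)) (V b c d) d := by
  intro a b c d
  have hv : (v : R) * (v⁻¹ : Rˣ) = 1 := v.mul_inv
  simp only [hT, hV]
  linear_combination (v * b - c) * hcompat + (x * b - y * d) * hv
end

section
/- Let R be a commutative ring and let x, y, v ∈ R be units satisfying 1 + x·y = v⁻¹·x + v·y. Define [a,b,c] = x·a − x·y·b + y·c and ⟨a,b,c⟩ = v·a − b + v⁻¹·c. Then the pair ([,,], ⟨,,⟩) satisfies every virtual tribracket axiom; explicitly: (1) each of the three maps obtained from [a,b,c] by fixing two of a,b,c is a bijection of R, and likewise for ⟨a,b,c⟩; (2) ⟨a,⟨a,b,c⟩,c⟩ = b for all a,b,c ∈ R; (3) [a,b,[b,c,d]] = [a,[a,b,c],[[a,b,c],c,d]] and [[a,b,c],c,d] = [[a,b,[b,c,d]],[b,c,d],d] for all a,b,c,d ∈ R; (4) ⟨a,b,⟨b,c,d⟩⟩ = ⟨a,⟨a,b,c⟩,⟨⟨a,b,c⟩,c,d⟩⟩ and ⟨⟨a,b,c⟩,c,d⟩ = ⟨⟨a,b,⟨b,c,d⟩⟩,⟨b,c,d⟩,d⟩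 for all a,b,c,d ∈ R; (5) [a,b,⟨b,c,d⟩] = ⟨a,⟨a,b,c⟩,[⟨a,b,c⟩,c,d]⟩ and [⟨a,b,c⟩,c,d] = ⟨[a,b,⟨b,c,d⟩],⟨b,c,d⟩,d⟩ for all a,b,c,d ∈ R. -/
/-- An affine map of a commutative ring whose linear coefficient is a unit is bijective. -/
theorem bijective_of_eq_unit_mul_add {R : Type*} [CommRing R] (u : Rˣ) (k : R) {f : R → R}
    (hf : ∀ t, f t = u * t + k) : Function.Bijective f := by
  have h : f = (Equiv.addRight k) ∘ u.mulLeft := funext hf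
  rw [h]
  exact (Equiv.addRight k).bijective.comp u.mulLeft.bijective


/-- The Alexander virtual tribracket: on a commutative ring `R` with units
`x, y, v` satisfying `1 + x·y = v⁻¹·x + v·y`, the operations
`T a b c = x·a − x·y·b + y·c` and `V a b c = v·a − b + v⁻¹·c` satisfy all the
virtual tribracket axioms. -/
theorem alexander_virtual_tribracket {R : Type*} [CommRing R] (x y v : Rˣ)
    (hcompat : (1 : R) + x * y = (v⁻¹ : Rˣ) * x + v * y)
    (T : R → R → R → R) (hT : ∀ a b c : R, T a b c = x * a - x * y * b + y * c)
    (V : R → R → R → R) (hV : ∀ a b c : R, V a b c = v * a - b + (v⁻¹ : Rˣ) * c) :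
    -- (1) each operation is bijective in each argument with the other two fixed
    (∀ b c : R, Function.Bijective (fun a : R => T a b c)) ∧
    (∀ a c : R, Function.Bijective (fun b : R => T a b c)) ∧
    (∀ a b : R, Function.Bijective (fun c : R => T a b c)) ∧
    (∀ b c : R, Function.Bijective (fun a : R => V a b c)) ∧
    (∀ a c : R, Function.Bijective (fun b : R => V a b c)) ∧
    (∀ a b : R, Function.Bijective (fun c : R => V a b c)) ∧
    -- (2) axiom (vii)
    (∀ a b c : R, V a (V a b c) c = b) ∧
    -- (3) exchange identities for T
    (∀ a b c d : R, T a b (T b c d) = T a (T a b c) (T (T a b c) c d)) ∧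
    (∀ a b c d : R, T (T a b c) c d = T (T a b (T b c d)) (T b c d) d) ∧
    -- (4) exchange identities for V
    (∀ a b c d : R, V a b (V b c d) = V a (V a b c) (V (V a b c) c d)) ∧
    (∀ a b c d : R, V (V a b c) c d = V (V a b (V b c d)) (V b c d) d) ∧
    -- (5) mixed identities
    (∀ a b c d : R, T a b (V b c d) = V a (V a b c) (T (V a b c) c d)) ∧
    (∀ a b c d : R, T (V a b c) c d = V (T a b (V b c d)) (V b c d) d) := by
  have hvw : (v : R) * (v⁻¹ : Rˣ) = 1 := v.mul_inv
  refine ⟨fun b c => bijective_of_eq_unit_mul_add x (-(x * y * b) + y * c) fun t => ?_,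
    fun a c => bijective_of_eq_unit_mul_add (-(x * y)) (x * a + y * c) fun t => ?_,
    fun a b => bijective_of_eq_unit_mul_add y (x * a - x * y * b) fun t => ?_,
    fun b c => bijective_of_eq_unit_mul_add v (-b + (v⁻¹ : Rˣ) * c) fun t => ?_,
    fun a c => bijective_of_eq_unit_mul_add (-1) (v * a + (v⁻¹ : Rˣ) * c) fun t => ?_,
    fun a b => bijective_of_eq_unit_mul_add v⁻¹ (v * a - b) fun t => ?_,
    fun a b c => ?_, fun a b c d => ?_, fun a b c d => ?_, fun a b c d => ?_,
    fun a b c d => ?_, fun a b c d => ?_, fun a b c d => ?_⟩ <;>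
  simp only [hT, hV, Units.val_neg, Units.val_mul, Units.val_one] <;>
  generalize ((v⁻¹ : Rˣ) : R) = w at * <;>
  grind
end
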